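/- arXiv:2108.01457 — 4 statements merged into one kernel-verified Lean document; each statement's English description precedes it below -/
import Mathlib

section
/- Main theorem (strong duality via lossless convexification): let D ⊆ ℝⁿ be nonempty, f : ℝⁿ → ℝ continuous, and Φ_i : ℝⁿ → Sym(n̂,ℝ) continuous for i = 1,…,N, and suppose the primal infimum p* = inf { f(x) : x ∈ D, Φ_i(x) ⪯ 0 for all i } is finite and attained. Suppose there exist h : ℝⁿ → ℝᵐ with h(D) convex, a convex function f' : ℝᵐ → ℝ, and maps Φ'_i : ℝᵐ → Sym(n̂,ℝ) that are matrix-convex on h(D) (Φ'_i(θu + (1−θ)v) ⪯ θΦ'_i(u) + (1−θ)Φ'_i(v) for all u,v ∈ h(D), θ ∈ [0,1]) such that f(x) = f'(h(x)) and Φ_i(x) = Φ'_i(h(x)) for all x ∈ D, and such that h maps F = {x ∈ D : Φ_i(x) ⪯ 0 ∀i} onto F' = {v ∈ h(D) : Φ'_i(v) ⪯ 0 ∀i} (surjectivity of h restricted to F). Suppose also Slater's condition: there exists x̃ in the relative interior of D with Φ_i(x̃) ≺ 0 (negative definite) for all i. Then strong duality holds: d* = p*, where d* = sup { g(Λ)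 : Λ₁,…,Λ_N ⪰ 0 } with g(Λ) = inf_{x ∈ D} ( f(x) + Σ_{i=1}^N tr(Λ_i Φ_i(x)) ); moreover the supremum is attained. -/
open Matrix Set

namespace Matrix

variable {k : Type*} [Fintype k]

/-- The trace of the product of two real positive semidefinite matrices is nonnegative. -/
lemma PosSemidef.trace_mul_nonneg {A B : Matrix k k ℝ} (hA : A.PosSemidef) (hB : B.PosSemidef) :
    0 ≤ (A * B).trace := by
  classical
  have h := (hA.hadamard hB).dotProduct_mulVec_nonneg (fun _ ↦ 1)
  refine h.trans_eq (Eq.symm ?_)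
  simp only [trace, diag_apply, mul_apply, dotProduct, mulVec, hadamard_apply, Pi.star_apply,
    star_one, one_mul, mul_one]
  refine Finset.sum_congr rfl fun i _ ↦ Finset.sum_congr rfl fun j _ ↦ ?_
  rw [← hB.isHermitian.apply i j, star_trivial]

/-- On symmetric matrices, every linear functional is the trace against a symmetric matrix. -/
lemma exists_isSymm_forall_eq_trace_mul [DecidableEq k] (ψ : Matrix k k ℝ →ₗ[ℝ] ℝ) :
    ∃ L : Matrix k k ℝ, L.IsSymm ∧ ∀ M : Matrix k k ℝ, M.IsSymm → ψ M = (L * M).trace := by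
  set K : Matrix k k ℝ := of fun a b ↦ ψ (single b a 1) with hK
  have key (M : Matrix k k ℝ) : ψ M = (K * M).trace := by
    conv_lhs => rw [matrix_eq_sum_single M]
    simp only [map_sum, trace, diag_apply, mul_apply, hK, of_apply]
    rw [Finset.sum_comm]
    refine Finset.sum_congr rfl fun i _ ↦ Finset.sum_congr rfl fun j _ ↦ ?_
    rw [show single j i (M j i) = M j i • single j i (1 : ℝ) by simp [smul_single], map_smul,
      smul_eq_mul, mul_comm]
  refine ⟨(1 / 2 : ℝ) • (K + Kᵀ), ?_, fun M hM ↦ ?_⟩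
  · rw [IsSymm, transpose_smul, transpose_add, transpose_transpose, add_comm]
  · have h : (Kᵀ * M).trace = (K * M).trace := by
      rw [← trace_transpose, transpose_mul, transpose_transpose, hM.eq, trace_mul_comm]
    rw [key, smul_mul, add_mul, trace_smul, trace_add, h, smul_eq_mul]
    ring

/-- A symmetric matrix whose trace against every positive semidefinite matrix is nonnegative is
positive semidefinite. -/
lemma IsSymm.posSemidef_of_trace_mul_nonneg {L : Matrix k k ℝ} (hL : L.IsSymm)
    (h : ∀ P : Matrix k k ℝ, P.PosSemidef → 0 ≤ (L * P).trace) : L.PosSemidef := by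
  refine .of_dotProduct_mulVec_nonneg ?_ fun y ↦ ?_
  · rw [IsHermitian, conjTranspose_eq_transpose_of_trivial, hL.eq]
  · have := h _ (posSemidef_vecMulVec_self_star y)
    rwa [mul_vecMulVec, trace_vecMulVec, dotProduct_comm] at this

/-- A real quadratic form that is positive away from the origin stays so when its matrix is
perturbed slightly. -/
lemma isOpen_setOf_forall_dotProduct_mulVec_pos :
    IsOpen {M : Matrix k k ℝ | ∀ y, y ≠ 0 → 0 < y ⬝ᵥ M *ᵥ y} := by
  have heq : {M : Matrix k k ℝ | ∀ y, y ≠ 0 → 0 < y ⬝ᵥ M *ᵥ y} =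
      {M | ∀ y ∈ Metric.sphere (0 : k → ℝ) 1, 0 < y ⬝ᵥ M *ᵥ y} := by
    ext M
    refine ⟨fun h y hy ↦ h y ?_, fun h y hy ↦ ?_⟩
    · exact ne_zero_of_mem_unit_sphere (⟨y, hy⟩ : Metric.sphere (0 : k → ℝ) 1)
    · have hn : 0 < ‖y‖ := norm_pos_iff.mpr hy
      have := h (‖y‖⁻¹ • y) (by simp [norm_smul, hn.ne'])
      rw [mulVec_smul, smul_dotProduct, dotProduct_smul, smul_eq_mul, smul_eq_mul] at this
      have hi : 0 < ‖y‖⁻¹ := inv_pos.mpr hn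
      exact pos_of_mul_pos_right (pos_of_mul_pos_right this hi.le) hi.le
  rw [heq, isOpen_iff_eventually]
  intro M hM
  refine (isCompact_sphere (0 : k → ℝ) 1).eventually_forall_of_forall_eventually fun y hy ↦ ?_
  have hc : Continuous fun z : Matrix k k ℝ × (k → ℝ) ↦ z.2 ⬝ᵥ z.1 *ᵥ z.2 :=
    continuous_snd.dotProduct (continuous_fst.matrix_mulVec continuous_snd)
  exact hc.continuousAt.eventually_const_lt (hM y hy)

/-- Lagrange multipliers for a convex program with semidefinite constraints satisfying Slater's
condition: a lower bound on the objective over the feasible set is a lower bound on some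
Lagrangian. -/
lemma exists_posSemidef_forall_le_lagrangian {ι E : Type*} [Fintype ι] [DecidableEq k]
    [AddCommGroup E] [Module ℝ E] {C : Set E} {g : E → ℝ} (hg : ConvexOn ℝ C g)
    {G : ι → E → Matrix k k ℝ} (hGsymm : ∀ i, ∀ v ∈ C, (G i v).IsSymm)
    (hG : ∀ i, ∀ u ∈ C, ∀ v ∈ C, ∀ θ : ℝ, 0 ≤ θ → θ ≤ 1 →
      (θ • G i u + (1 - θ) • G i v - G i (θ • u + (1 - θ) • v)).PosSemidef)
    {p : ℝ} (hp : ∀ v ∈ C, (∀ i, (-G i v).PosSemidef) → p ≤ g v)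
    {v₀ : E} (hv₀ : v₀ ∈ C) (hslater : ∀ i, (-G i v₀).PosDef) :
    ∃ Λ : ι → Matrix k k ℝ, (∀ i, (Λ i).PosSemidef) ∧
      ∀ v ∈ C, p ≤ g v + ∑ i, (Λ i * G i v).trace := by
  classical
  set S : Set ((ι → Matrix k k ℝ) × ℝ) :=
    {z | ∃ v ∈ C, g v < z.2 ∧ ∀ i, ∀ y, y ≠ 0 → 0 < y ⬝ᵥ (z.1 i - G i v) *ᵥ y} with hS
  have hSopen : IsOpen S := by
    have : S = ⋃ v ∈ C, {z | g v < z.2} ∩ ⋂ i, (fun z : (ι → Matrix k k ℝ) × ℝ ↦ z.1 i - G i v) ⁻¹'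
        {M : Matrix k k ℝ | ∀ y, y ≠ 0 → 0 < y ⬝ᵥ M *ᵥ y} := by
      ext z
      simp [hS, and_left_comm]
    rw [this]
    refine isOpen_biUnion fun v _ ↦ (isOpen_lt continuous_const continuous_snd).inter
      (isOpen_iInter_of_finite fun i ↦ isOpen_setOf_forall_dotProduct_mulVec_pos.preimage ?_)
    exact ((continuous_apply i).comp continuous_fst).sub continuous_const
  have hSconv : Convex ℝ S := by
    rintro ⟨M₁, r₁⟩ ⟨v₁, hv₁, hr₁, hM₁⟩ ⟨M₂, r₂⟩ ⟨v₂, hv₂, hr₂, hM₂⟩ a b ha hb hab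
    refine ⟨a • v₁ + b • v₂, hg.1 hv₁ hv₂ ha hb hab, ?_, fun i y hy ↦ ?_⟩
    · refine (hg.2 hv₁ hv₂ ha hb hab).trans_lt ?_
      have := convex_Ioi (0 : ℝ) (sub_pos.mpr hr₁) (sub_pos.mpr hr₂) ha hb hab
      simp only [mem_Ioi, smul_eq_mul, Prod.snd_add, Prod.smul_snd] at this ⊢
      linarith
    · have hpsd := (hG i v₁ hv₁ v₂ hv₂ a ha (by linarith)).dotProduct_mulVec_nonneg y
      obtain rfl : b = 1 - a := by linarith
      have h₁ := hM₁ i y hy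
      have h₂ := hM₂ i y hy
      have hpos := convex_Ioi (0 : ℝ) h₁ h₂ ha hb hab
      simp only [star_trivial, sub_mulVec, add_mulVec, smul_mulVec, dotProduct_sub,
        dotProduct_add, dotProduct_smul, smul_eq_mul, Prod.fst_add, Prod.smul_fst, Pi.add_apply,
        Pi.smul_apply, mem_Ioi] at hpsd hpos ⊢
      linarith
  have hnot : ((0 : ι → Matrix k k ℝ), p) ∉ S := by
    rintro ⟨v, hv, hlt, hneg⟩
    refine hlt.not_ge (hp v hv fun i ↦ ?_)
    refine .of_dotProduct_mulVec_nonneg ?_ fun y ↦ ?_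
    · rw [IsHermitian, conjTranspose_eq_transpose_of_trivial, transpose_neg, (hGsymm i v hv).eq]
    · rcases eq_or_ne y 0 with rfl | hy
      · simp
      · simpa using (hneg i y hy).le
  obtain ⟨φ, hφ⟩ := geometric_hahn_banach_point_open hSconv hSopen hnot
  set ψ : (ι → Matrix k k ℝ) →ₗ[ℝ] ℝ := φ.toLinearMap ∘ₗ LinearMap.inl ℝ _ _
  set c : ℝ := φ (0, 1)
  have hsplit (M : ι → Matrix k k ℝ) (r : ℝ) : φ (M, r) = ψ M + r * c := by
    have : ((M, r) : (ι → Matrix k k ℝ) × ℝ) = (M, 0) + r • (0, 1) := by simp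
    rw [this, map_add, map_smul]
    rfl
  have key {v : E} (hv : v ∈ C) {P : ι → Matrix k k ℝ} (hP : ∀ i, (P i).PosDef) {ε : ℝ}
      (hε : 0 < ε) : p * c < ψ (fun i ↦ G i v) + ψ P + (g v + ε) * c := by
    have := hφ ((fun i ↦ G i v) + P, g v + ε) ⟨v, hv, by simpa using hε, fun i y hy ↦ by
      simpa using (hP i).dotProduct_mulVec_pos hy⟩
    rwa [hsplit, hsplit, map_zero, zero_add, map_add] at this
  have nonneg_of_ray {a b : ℝ} (h : ∀ t : ℝ, 0 < t → 0 < a + t * b) : 0 ≤ b := by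
    by_contra! hb
    have hpos : 0 < (|a| + 1) / -b := by have := abs_nonneg a; apply div_pos <;> linarith
    have h' := h _ hpos
    have : (|a| + 1) / -b * b = -(|a| + 1) := by
      rw [div_neg, neg_mul, div_mul_cancel₀ _ hb.ne]
    linarith [le_abs_self a]
  have le_of_eps {a b : ℝ} (h : ∀ t : ℝ, 0 < t → 0 ≤ a + t * b) : 0 ≤ a := by
    have hc : ContinuousWithinAt (fun t ↦ a + t * b) (Ioi 0) 0 := by fun_prop
    have := ge_of_tendsto hc (eventually_mem_nhdsWithin.mono fun t ht ↦ h t ht)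
    simpa using this
  have hone : ∀ i : ι, (1 : Matrix k k ℝ).PosDef := fun _ ↦ .one
  have hc0 : 0 ≤ c := nonneg_of_ray (a := ψ (fun i ↦ G i v₀) + ψ 1 + g v₀ * c - p * c)
    fun t ht ↦ by linarith [key hv₀ (P := 1) hone ht]
  have hψdef {P : ι → Matrix k k ℝ} (hP : ∀ i, (P i).PosDef) : 0 ≤ ψ P :=
    nonneg_of_ray (a := ψ (fun i ↦ G i v₀) + (g v₀ + 1) * c - p * c) fun t ht ↦ by
      have := key hv₀ (P := t • P) (fun i ↦ (hP i).smul ht) one_pos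
      rw [map_smul, smul_eq_mul] at this
      linarith
  have hψsemidef {P : ι → Matrix k k ℝ} (hP : ∀ i, (P i).PosSemidef) : 0 ≤ ψ P :=
    le_of_eps (b := ψ 1) fun t ht ↦ by
      have := hψdef (P := P + t • (1 : ι → Matrix k k ℝ)) fun i ↦
        PosDef.posSemidef_add (hP i) ((hone i).smul ht)
      rwa [map_add, map_smul, smul_eq_mul] at this
  have hbound {v : E} (hv : v ∈ C) : p * c ≤ ψ (fun i ↦ G i v) + g v * c := by
    have := le_of_eps (a := ψ (fun i ↦ G i v) + g v * c - p * c) (b := ψ 1 + c)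
      fun t ht ↦ by
        have := key hv (P := t • 1) (fun i ↦ (hone i).smul ht) ht
        rw [map_smul, smul_eq_mul] at this
        linarith
    linarith
  have hcpos : 0 < c := by
    refine hc0.lt_of_ne fun h0 ↦ ?_
    have := key hv₀ (P := -fun i ↦ G i v₀) hslater one_pos
    rw [map_neg, ← h0] at this
    linarith
  choose L hLsymm hL using fun i : ι ↦
    exists_isSymm_forall_eq_trace_mul (ψ ∘ₗ LinearMap.single ℝ (fun _ : ι ↦ Matrix k k ℝ) i)
  have hLsemidef (i : ι) : (L i).PosSemidef :=
    (hLsymm i).posSemidef_of_trace_mul_nonneg fun P hP ↦ by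
      rw [← hL i P (by simpa [IsHermitian, IsSymm] using hP.isHermitian)]
      refine hψsemidef fun j ↦ ?_
      rcases eq_or_ne j i with rfl | hj
      · simpa using hP
      · simpa [hj] using PosSemidef.zero
  refine ⟨fun i ↦ c⁻¹ • L i, fun i ↦ (hLsemidef i).smul (inv_nonneg.mpr hc0), fun v hv ↦ ?_⟩
  have hsum : ψ (fun i ↦ G i v) = ∑ i, (L i * G i v).trace := by
    rw [← LinearMap.sum_single_apply (fun _ ↦ Matrix k k ℝ) (fun i ↦ G i v), map_sum]
    exact Finset.sum_congr rfl fun i _ ↦ hL i _ (hGsymm i v hv)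
  have h := hbound hv
  simp only [smul_mul, trace_smul, smul_eq_mul, ← Finset.mul_sum, ← hsum]
  refine le_of_mul_le_mul_right (h.trans_eq ?_) hcpos
  field_simp
  ring

end Matrix

/-- Main theorem: strong duality via lossless convexification. If the non-convex primal
SDP admits a lossless convexification (a map `h` with `h '' D` convex, a convex objective
`f'`, matrix-convex constraints `Φ' i` on `h '' D`, with `f = f' ∘ h`, `Φ i = Φ' i ∘ h`
on `D`, and `h` mapping the primal feasible set onto the convexified feasible set), and
Slater's condition holds (a point in the relative interior of `D` where all constraints
are negative definite), then the dual optimal value equals the primal optimal value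
`p*` and the dual supremum is attained. -/
theorem strong_duality_of_lossless_convexification
    (n m nh N : ℕ)
    (D : Set (Fin n → ℝ)) (hDne : D.Nonempty)
    (f : (Fin n → ℝ) → ℝ) (hfcont : Continuous f)
    (Φ : Fin N → (Fin n → ℝ) → Matrix (Fin nh) (Fin nh) ℝ)
    (hΦcont : ∀ i, Continuous (Φ i))
    (hΦsymm : ∀ i x, (Φ i x).IsSymm)
    -- the primal optimal value is finite and attained:
    (pstar : ℝ)
    (hp : IsLeast {r : ℝ | ∃ x ∈ D, (∀ i, (-(Φ i x)).PosSemidef) ∧ f x = r} pstar)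
    -- the lossless convexification:
    (h : (Fin n → ℝ) → (Fin m → ℝ))
    (hhD : Convex ℝ (h '' D))
    (f' : (Fin m → ℝ) → ℝ) (hf'conv : ConvexOn ℝ Set.univ f')
    (Φ' : Fin N → (Fin m → ℝ) → Matrix (Fin nh) (Fin nh) ℝ)
    (hΦ'conv : ∀ i, ∀ u ∈ h '' D, ∀ v ∈ h '' D, ∀ θ : ℝ, 0 ≤ θ → θ ≤ 1 →
      (θ • Φ' i u + (1 - θ) • Φ' i v - Φ' i (θ • u + (1 - θ) • v)).PosSemidef)
    (hfh : ∀ x ∈ D, f x = f' (h x))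
    (hΦh : ∀ i, ∀ x ∈ D, Φ i x = Φ' i (h x))
    -- `h` restricted to the feasible set `F` is a surjection onto `F'`:
    (hsurj : h '' {x ∈ D | ∀ i, (-(Φ i x)).PosSemidef}
      = {v ∈ h '' D | ∀ i, (-(Φ' i v)).PosSemidef})
    -- Slater's condition:
    (xt : Fin n → ℝ) (hxt : xt ∈ intrinsicInterior ℝ D)
    (hslater : ∀ i, (-(Φ i xt)).PosDef) :
    (⨆ Λ : {Λ : Fin N → Matrix (Fin nh) (Fin nh) ℝ // ∀ i, (Λ i).PosSemidef},
        ⨅ x : D, ((f x + ∑ i, ((Λ.1 i) * (Φ i (x : Fin n → ℝ))).trace : ℝ) : EReal))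
      = (pstar : EReal) ∧
    ∃ Λ : Fin N → Matrix (Fin nh) (Fin nh) ℝ, (∀ i, (Λ i).PosSemidef) ∧
      (⨅ x : D, ((f x + ∑ i, ((Λ i) * (Φ i (x : Fin n → ℝ))).trace : ℝ) : EReal))
        = (pstar : EReal) := by
  have hle (Λ : Fin N → Matrix (Fin nh) (Fin nh) ℝ) (hΛ : ∀ i, (Λ i).PosSemidef) :
      (⨅ x : D, ((f x + ∑ i, ((Λ i) * (Φ i (x : Fin n → ℝ))).trace : ℝ) : EReal))
        ≤ (pstar : EReal) := by
    obtain ⟨x, hxD, hx, hfx⟩ := hp.1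
    refine (iInf_le _ (⟨x, hxD⟩ : D)).trans (EReal.coe_le_coe_iff.mpr ?_)
    have : ∑ i, (Λ i * Φ i x).trace ≤ 0 := Finset.sum_nonpos fun i _ ↦ by
      simpa using (hΛ i).trace_mul_nonneg (hx i)
    dsimp only
    linarith
  have hxtD := intrinsicInterior_subset hxt
  obtain ⟨Λ, hΛ, hbound⟩ := Matrix.exists_posSemidef_forall_le_lagrangian (C := h '' D) (g := f')
    (G := Φ') (p := pstar) (hf'conv.subset (subset_univ _) hhD)
    (by
      rintro i _ ⟨x, hx, rfl⟩
      exact hΦh i x hx ▸ hΦsymm i x)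
    hΦ'conv
    (by
      rintro _ ⟨x, hx, rfl⟩ hneg
      exact hp.2 ⟨x, hx, fun i ↦ hΦh i x hx ▸ hneg i, hfh x hx⟩)
    (mem_image_of_mem h hxtD) (fun i ↦ hΦh i xt hxtD ▸ hslater i)
  have heq : (⨅ x : D, ((f x + ∑ i, ((Λ i) * (Φ i (x : Fin n → ℝ))).trace : ℝ) : EReal))
      = (pstar : EReal) := by
    refine (hle Λ hΛ).antisymm (le_iInf fun ⟨x, hx⟩ ↦ EReal.coe_le_coe_iff.mpr ?_)
    simpa only [hfh x hx, hΦh _ x hx] using hbound (h x) (mem_image_of_mem h hx)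
  refine ⟨le_antisymm (iSup_le fun Λ ↦ hle Λ.1 Λ.2) ?_, Λ, hΛ, heq⟩
  exact heq.ge.trans (le_iSup (fun Λ : {Λ : Fin N → Matrix (Fin nh) (Fin nh) ℝ //
    ∀ i, (Λ i).PosSemidef} ↦ ⨅ x : D, ((f x + ∑ i,
      ((Λ.1 i) * (Φ i (x : Fin n → ℝ))).trace : ℝ) : EReal)) ⟨Λ, hΛ⟩)
end

section
/- Claim 3 (Slater feasibility for continuous-time state-feedback stabilization): let A ∈ ℝ^{n×n} and B ∈ ℝ^{n×m}, and suppose (A,B) is stabilizable, i.e., there exists F ∈ ℝ^{m×n} such that every eigenvalue of A + BF (regarded as a complex matrix) has negative real part. Then there exist a real ε > 0, a symmetric matrix P ∈ Sym(n,ℝ), and F ∈ ℝ^{m×n} such that (A + BF)P + P(A + BF)ᵀ + εI ⪯ 0 and εI − P ⪯ 0. -/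
open Matrix

open Filter Topology

section SpectralRadius

attribute [local instance] Matrix.linftyOpNormedRing Matrix.linftyOpNormedAlgebra

/-- Powers of a complex matrix whose eigenvalues lie in the open unit disc tend to zero. -/
theorem Matrix.tendsto_pow_zero_of_spectrum_norm_lt_one {ι : Type*} [Fintype ι] [DecidableEq ι]
    (C : Matrix ι ι ℂ) (h : ∀ z ∈ spectrum ℂ C, ‖z‖ < 1) :
    Tendsto (fun k : ℕ => C ^ k) atTop (𝓝 0) := by
  rcases isEmpty_or_nonempty ι with hι | hι
  · exact tendsto_const_nhds.congr fun k => Subsingleton.elim _ _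
  have hr : spectralRadius ℂ C < (1 : NNReal) :=
    spectrum.spectralRadius_lt_of_forall_lt C fun z hz => h z hz
  obtain ⟨r, hr₁, hr₂⟩ := ENNReal.lt_iff_exists_nnreal_btwn.1 hr
  have hr₂' : r < 1 := by exact_mod_cast hr₂
  have hev := (spectrum.pow_nnnorm_pow_one_div_tendsto_nhds_spectralRadius C).eventually
    (gt_mem_nhds hr₁)
  refine squeeze_zero_norm' (a := fun k : ℕ => (r : ℝ) ^ k) ?_
    (tendsto_pow_atTop_nhds_zero_of_lt_one r.2 (by exact_mod_cast hr₂'))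
  filter_upwards [hev, eventually_gt_atTop 0] with k hk hk0
  have hk0' : (0 : ℝ) < k := by exact_mod_cast hk0
  have h1 := ENNReal.rpow_le_rpow hk.le hk0'.le
  rw [← ENNReal.rpow_mul, one_div, inv_mul_cancel₀ hk0'.ne', ENNReal.rpow_one,
    ENNReal.rpow_natCast] at h1
  exact_mod_cast h1

/-- If `E k → 0` with every `E k` real symmetric, then `1 - E k` is eventually positive
definite. -/
theorem Matrix.eventually_posDef_one_sub {ι : Type*} [Fintype ι] [DecidableEq ι]
    (E : ℕ → Matrix ι ι ℝ) (hE : ∀ k, (E k).IsHermitian) (h : Tendsto E atTop (𝓝 0)) :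
    ∀ᶠ k in atTop, (1 - E k).PosDef := by
  have h1 : Tendsto (fun k => ‖E k‖ * ‖(1 : Matrix ι ι ℝ)‖) atTop (𝓝 0) := by
    simpa using h.norm.mul_const ‖(1 : Matrix ι ι ℝ)‖
  filter_upwards [h1.eventually (gt_mem_nhds one_pos)] with k hk
  have hH : (1 - E k).IsHermitian := isHermitian_one.sub (hE k)
  rw [hH.posDef_iff_eigenvalues_pos]
  intro i
  have hi := hH.eigenvalues_mem_spectrum_real i
  generalize hH.eigenvalues i = x at hi ⊢
  rw [← map_one (algebraMap ℝ (Matrix ι ι ℝ)), ← spectrum.singleton_sub_eq] at hi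
  obtain ⟨a, ha, b, hb, hab⟩ := hi
  have hb' := (spectrum.norm_le_norm_mul_of_mem hb).trans_lt hk
  rw [Real.norm_eq_abs] at hb'
  have ha' : a = 1 := ha
  have := (abs_lt.1 hb').2
  simp only at hab
  linarith

end SpectralRadius

/-- A real positive definite matrix dominates all sufficiently small multiples of the identity. -/
theorem Matrix.PosDef.exists_forall_posSemidef_sub_smul_one {ι : Type*} [Fintype ι] [DecidableEq ι]
    {S : Matrix ι ι ℝ} (hS : S.PosDef) :
    ∃ ε : ℝ, 0 < ε ∧ ∀ δ ≤ ε, (S - δ • (1 : Matrix ι ι ℝ)).PosSemidef := by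
  obtain ⟨ε, hε, hle⟩ : ∃ ε > 0, ∀ i, ε ≤ hS.isHermitian.eigenvalues i := by
    rcases isEmpty_or_nonempty ι with hι | hι
    · exact ⟨1, one_pos, fun i => isEmptyElim i⟩
    · obtain ⟨i, hi⟩ := Finite.exists_min hS.isHermitian.eigenvalues
      exact ⟨_, hS.eigenvalues_pos i, hi⟩
  refine ⟨ε, hε, fun δ hδ => ?_⟩
  rw [posSemidef_iff_isHermitian_and_spectrum_nonneg]
  refine ⟨hS.isHermitian.sub (by simp [IsHermitian]), ?_⟩
  rw [← Algebra.algebraMap_eq_smul_one, ← spectrum.sub_singleton_eq,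
    hS.isHermitian.spectrum_real_eq_range_eigenvalues]
  rintro _ ⟨_, ⟨i, rfl⟩, b, hb, rfl⟩
  have hb' : b = δ := hb
  have := hle i
  simp only [Set.mem_ofPred_eq]
  linarith

/-- The discrete-time Lyapunov inequality: if the powers of `C` tend to zero, then
`P - C P Cᵀ` is positive definite for some positive definite `P`. -/
theorem Matrix.exists_posDef_sub_mul_mul_transpose {ι : Type*} [Fintype ι] [DecidableEq ι]
    (C : Matrix ι ι ℝ) (h : Tendsto (fun k : ℕ => C ^ k) atTop (𝓝 0)) :
    ∃ P : Matrix ι ι ℝ, P.PosDef ∧ (P - C * P * Cᵀ).PosDef := by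
  have hE : Tendsto (fun k : ℕ => C ^ k * (C ^ k)ᵀ) atTop (𝓝 0) := by
    have := h.mul ((continuous_id.matrix_transpose.tendsto (0 : Matrix ι ι ℝ)).comp h)
    simpa using this
  obtain ⟨N, hN, hN0⟩ := ((eventually_posDef_one_sub _
    (fun k => isHermitian_mul_conjTranspose_self (C ^ k)) hE).and (eventually_gt_atTop 0)).exists
  obtain ⟨N, rfl⟩ := Nat.exists_eq_succ_of_ne_zero hN0.ne'
  refine ⟨∑ k ∈ Finset.range (N + 1), C ^ k * (C ^ k)ᵀ, ?_, ?_⟩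
  · rw [Finset.sum_range_succ']
    refine PosDef.posSemidef_add (posSemidef_sum _ fun k _ => ?_) ?_
    · exact posSemidef_self_mul_conjTranspose (C ^ (k + 1))
    · simpa using PosDef.one
  · convert hN using 1
    have hs : C * (∑ k ∈ Finset.range (N + 1), C ^ k * (C ^ k)ᵀ) * Cᵀ
        = ∑ k ∈ Finset.range (N + 1), C ^ (k + 1) * (C ^ (k + 1))ᵀ := by
      simp only [Finset.mul_sum, Finset.sum_mul, pow_succ', transpose_mul, Matrix.mul_assoc]
    rw [hs, ← Finset.sum_sub_distrib, Finset.sum_range_sub']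
    simp

/-- The Cayley transform maps Hurwitz matrices to matrices with spectrum in the open unit disc. -/
theorem Matrix.norm_lt_one_of_mem_spectrum_cayley {ι : Type*} [Fintype ι] [DecidableEq ι]
    {M C : Matrix ι ι ℂ} (hM : ∀ μ ∈ spectrum ℂ M, μ.re < 0) (hC : C * (1 - M) = 1 + M)
    (z : ℂ) (hz : z ∈ spectrum ℂ C) : ‖z‖ < 1 := by
  by_contra! hn
  refine hz ?_
  have hu : IsUnit (1 - M) := by
    by_contra hu
    have h1 : (1 : ℂ) ∈ spectrum ℂ M := by simpa [spectrum.mem_iff] using hu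
    have := hM _ h1
    norm_num at this
  have key : (algebraMap ℂ (Matrix ι ι ℂ) z - C) * (1 - M) = (z - 1) • 1 - (z + 1) • M := by
    rw [sub_mul, hC, Algebra.algebraMap_eq_smul_one, smul_mul_assoc, one_mul]
    module
  suffices h : IsUnit ((z - 1) • (1 : Matrix ι ι ℂ) - (z + 1) • M) by
    rw [← key] at h
    exact (hu.mul_right_iff).1 h
  by_cases hz1 : z + 1 = 0
  · have : z = -1 := by linear_combination hz1
    subst this
    have h2 : ((-1 : ℂ) - 1) ≠ 0 := by norm_num
    simpa [Units.smul_def] using (isUnit_one (M := Matrix ι ι ℂ)).smul (Units.mk0 _ h2)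
  · have hμ : (z - 1) / (z + 1) ∉ spectrum ℂ M := by
      intro hmem
      have := hM _ hmem
      rw [Complex.div_re, ← add_div, div_lt_iff₀ (Complex.normSq_pos.2 hz1)] at this
      have hsq : 1 ≤ z.re * z.re + z.im * z.im := by
        rw [← Complex.normSq_apply, Complex.normSq_eq_norm_sq]
        nlinarith
      simp at this
      nlinarith
    rw [spectrum.mem_iff, not_not] at hμ
    have h3 := hμ.smul (Units.mk0 _ hz1)
    convert h3 using 1
    rw [Units.smul_def, Units.val_mk0, smul_sub, Algebra.algebraMap_eq_smul_one, smul_smul,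
      mul_div_cancel₀ _ hz1]

/-- Lyapunov's theorem: a real Hurwitz matrix `M` admits a positive definite `P` with
`M P + P Mᵀ` negative definite. -/
theorem Matrix.exists_posDef_lyapunov {ι : Type*} [Fintype ι] [DecidableEq ι]
    (M : Matrix ι ι ℝ) (hM : ∀ μ ∈ spectrum ℂ (M.map (Complex.ofReal ·)), μ.re < 0) :
    ∃ P : Matrix ι ι ℝ, P.PosDef ∧ (-(M * P + P * Mᵀ)).PosDef := by
  let φ : Matrix ι ι ℝ →+* Matrix ι ι ℂ := Complex.ofRealHom.mapMatrix
  have hM' : ∀ μ ∈ spectrum ℂ (φ M), μ.re < 0 := hM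
  have hu : IsUnit (1 - M) := by
    rw [isUnit_iff_isUnit_det, isUnit_iff_ne_zero]
    intro h0
    have h1 : (1 : ℂ) ∈ spectrum ℂ (φ M) := by
      have hd : (φ (1 - M)).det = 0 := by
        rw [← RingHom.map_det, h0, map_zero]
      rw [spectrum.mem_iff, map_one, isUnit_iff_isUnit_det, ← map_one φ, ← map_sub, hd]
      simp
    have := hM' _ h1
    norm_num at this
  set C : Matrix ι ι ℝ := (1 + M) * (1 - M)⁻¹ with hCdef
  have hC : C * (1 - M) = 1 + M := by
    rw [hCdef, Matrix.mul_assoc, nonsing_inv_mul _ ((isUnit_iff_isUnit_det _).1 hu),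
      Matrix.mul_one]
  have hCc : φ C * (1 - φ M) = 1 + φ M := by
    simpa using congrArg φ hC
  have hlim := tendsto_pow_zero_of_spectrum_norm_lt_one (φ C)
    (norm_lt_one_of_mem_spectrum_cayley hM' hCc)
  have hlim' : Tendsto (fun k : ℕ => C ^ k) atTop (𝓝 0) := by
    have hre := ((continuous_id.matrix_map Complex.continuous_re).tendsto
      (0 : Matrix ι ι ℂ)).comp hlim
    have h0 : (0 : Matrix ι ι ℂ).map Complex.re = 0 := by ext; simp
    simp only [id, h0] at hre
    refine hre.congr fun k => ?_
    rw [Function.comp_apply, ← map_pow]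
    ext i j
    simp [φ]
  obtain ⟨P, hP, hD⟩ := exists_posDef_sub_mul_mul_transpose C hlim'
  refine ⟨P, hP, ?_⟩
  have hS := hD.mul_mul_conjTranspose_same (B := 1 - M)
    (vecMul_injective_of_isUnit hu)
  have hcomm : (1 - M) * C = 1 + M := by
    have hc : Commute (1 - M) (1 + M) := by
      simp only [Commute, SemiconjBy]; noncomm_ring
    rw [hCdef, ← Matrix.mul_assoc, hc.eq, Matrix.mul_assoc,
      mul_nonsing_inv _ ((isUnit_iff_isUnit_det _).1 hu), Matrix.mul_one]
  clear_value C
  have heq : (1 - M) * (P - C * P * Cᵀ) * (1 - M)ᴴ = (2 : ℝ) • -(M * P + P * Mᵀ) := by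
    have h1 : (1 - M) * (C * P * Cᵀ) * (1 - M)ᵀ = (1 + M) * P * (1 + M)ᵀ := by
      rw [← hcomm, transpose_mul]
      simp only [Matrix.mul_assoc]
    rw [conjTranspose_eq_transpose_of_trivial, mul_sub, sub_mul, h1, two_smul]
    simp only [transpose_sub, transpose_add, transpose_one]
    noncomm_ring
  rw [heq] at hS
  have := hS.smul (show (0 : ℝ) < 1 / 2 by norm_num)
  rwa [smul_smul, show (1 / 2 : ℝ) * 2 = 1 by norm_num, one_smul] at this

/-- Claim 3: Slater feasibility for continuous-time state-feedback stabilization.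
If `(A, B)` is stabilizable (some gain `F` makes `A + BF` Hurwitz, i.e. every complex
eigenvalue has negative real part), then there exist `ε > 0`, a symmetric `P`, and a
gain `F` with `(A + BF) P + P (A + BF)ᵀ + ε I ⪯ 0` and `ε I − P ⪯ 0`. -/
theorem slater_feasibility_ct
    (n m : ℕ)
    (A : Matrix (Fin n) (Fin n) ℝ) (B : Matrix (Fin n) (Fin m) ℝ)
    (hstab : ∃ F : Matrix (Fin m) (Fin n) ℝ,
      ∀ μ ∈ spectrum ℂ ((A + B * F).map (Complex.ofReal ·)), μ.re < 0) :
    ∃ ε : ℝ, 0 < ε ∧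
      ∃ P : Matrix (Fin n) (Fin n) ℝ, P.IsSymm ∧
        ∃ F : Matrix (Fin m) (Fin n) ℝ,
          (-((A + B * F) * P + P * (A + B * F)ᵀ
              + ε • (1 : Matrix (Fin n) (Fin n) ℝ))).PosSemidef ∧
          (P - ε • (1 : Matrix (Fin n) (Fin n) ℝ)).PosSemidef := by
  obtain ⟨F, hF⟩ := hstab
  obtain ⟨P, hP, hL⟩ := Matrix.exists_posDef_lyapunov (A + B * F) hF
  obtain ⟨ε₁, hε₁, h₁⟩ := hP.exists_forall_posSemidef_sub_smul_one
  obtain ⟨ε₂, hε₂, h₂⟩ := hL.exists_forall_posSemidef_sub_smul_one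
  refine ⟨min ε₁ ε₂, lt_min hε₁ hε₂, P, ?_, F, ?_, h₁ _ (min_le_left _ _)⟩
  · simpa [IsHermitian, IsSymm] using hP.isHermitian
  · rw [neg_add, ← sub_eq_add_neg]
    exact h₂ _ (min_le_right _ _)
end

section
/- Convexity of the strictly feasible set of the convexified discrete-time Lyapunov inequality: fix A ∈ ℝ^{n×n}, B ∈ ℝ^{n×m}, and ε > 0. The set { (P,M) ∈ Sym(n,ℝ) × ℝ^{m×n} : P ≻ εI and (AP + BM) P⁻¹ (AP + BM)ᵀ − P + εI ≺ 0 } is a convex subset of Sym(n,ℝ) × ℝ^{m×n}. -/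
open Matrix

/-- Joint matrix convexity of the map `(X, P) ↦ X P⁻¹ Xᵀ` on positive definite `P`. -/
theorem Matrix.PosDef.posSemidef_convexCombo_mul_inv_mul_transpose_sub
    {k n : Type*} [Finite k] [Fintype n] [DecidableEq n]
    {X Y : Matrix k n ℝ} {P Q : Matrix n n ℝ} (hP : P.PosDef) (hQ : Q.PosDef)
    {a b : ℝ} (ha : 0 ≤ a) (hb : 0 ≤ b) (hPQ : (a • P + b • Q).PosDef) :
    (a • (X * P⁻¹ * Xᵀ) + b • (Y * Q⁻¹ * Yᵀ)
      - (a • X + b • Y) * (a • P + b • Q)⁻¹ * (a • X + b • Y)ᵀ).PosSemidef := by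
  have key {Z : Matrix k n ℝ} {R : Matrix n n ℝ} (hR : R.PosDef) :
      (fromBlocks (Z * R⁻¹ * Zᵀ) Z Zᴴ R).PosSemidef := by
    have := hR.isUnit.invertible
    rw [hR.fromBlocks₂₂, conjTranspose_eq_transpose_of_trivial, sub_self]
    exact .zero
  have h := ((key (Z := X) hP).smul ha).add ((key (Z := Y) hQ).smul hb)
  have := hPQ.isUnit.invertible
  rw [fromBlocks_smul, fromBlocks_smul, fromBlocks_add] at h
  have hT : a • Xᴴ + b • Yᴴ = (a • X + b • Y)ᴴ := by simp
  rwa [hT, hPQ.fromBlocks₂₂, conjTranspose_eq_transpose_of_trivial] at h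

theorem Matrix.PosDef.convexCombo {n : Type*} {P Q : Matrix n n ℝ}
    (hP : P.PosDef) (hQ : Q.PosDef) {a b : ℝ} (ha : 0 ≤ a) (hb : 0 ≤ b) (hab : a + b = 1) :
    (a • P + b • Q).PosDef := by
  rcases ha.eq_or_lt with rfl | ha
  · obtain rfl : b = 1 := by linarith
    simpa using hQ
  · exact (hP.smul ha).add_posSemidef (hQ.posSemidef.smul hb)

/-- Convexity of the strictly feasible set of the convexified discrete-time Lyapunov
inequality: the set of pairs `(P, M)` with `P` symmetric, `P ≻ ε I`, and
`(AP + BM) P⁻¹ (AP + BM)ᵀ − P + ε I ≺ 0` is convex. -/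
theorem dt_strict_feasible_convex
    (n m : ℕ) (A : Matrix (Fin n) (Fin n) ℝ) (B : Matrix (Fin n) (Fin m) ℝ)
    (ε : ℝ) (hε : 0 < ε) :
    Convex ℝ {p : Matrix (Fin n) (Fin n) ℝ × Matrix (Fin m) (Fin n) ℝ |
      p.1.IsSymm ∧ (p.1 - ε • (1 : Matrix (Fin n) (Fin n) ℝ)).PosDef ∧
      (-((A * p.1 + B * p.2) * p.1⁻¹ * (A * p.1 + B * p.2)ᵀ - p.1
          + ε • (1 : Matrix (Fin n) (Fin n) ℝ))).PosDef} := by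
  rintro ⟨P, M⟩ ⟨hPs, hP, hPM⟩ ⟨Q, N⟩ ⟨hQs, hQ, hQN⟩ a b ha hb hab
  dsimp only at hPs hP hPM hQs hQ hQN
  have posDef_of_sub {R : Matrix (Fin n) (Fin n) ℝ}
      (hR : (R - ε • (1 : Matrix (Fin n) (Fin n) ℝ)).PosDef) : R.PosDef := by
    simpa using hR.add (PosDef.one.smul hε)
  have hε_split : ε • (1 : Matrix (Fin n) (Fin n) ℝ) = a • ε • 1 + b • ε • 1 := by
    rw [← add_smul, hab, one_smul]
  have hX : A * (a • P + b • Q) + B * (a • M + b • N)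
      = a • (A * P + B * M) + b • (A * Q + B * N) := by
    simp only [Matrix.mul_add, Matrix.mul_smul, smul_add]
    abel
  refine ⟨(hPs.smul a).add (hQs.smul b), ?_, ?_⟩
  · convert hP.convexCombo hQ ha hb hab using 1
    simp only [Prod.fst_add, Prod.smul_fst, smul_sub]
    nth_rewrite 1 [hε_split]
    abel
  · have hP' := posDef_of_sub hP
    have hQ' := posDef_of_sub hQ
    have hgap := hP'.posSemidef_convexCombo_mul_inv_mul_transpose_sub
      (X := A * P + B * M) (Y := A * Q + B * N) hQ' ha hb (hP'.convexCombo hQ' ha hb hab)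
    convert (hPM.convexCombo hQN ha hb hab).add_posSemidef hgap using 1
    simp only [Prod.fst_add, Prod.smul_fst, Prod.snd_add, Prod.smul_snd, hX]
    nth_rewrite 1 [hε_split]
    simp only [smul_neg, smul_add, smul_sub]
    abel
end

section
/- Strong duality for Example 2: sup over λ₁ ≥ 0, λ₂ ≥ 0 of inf over (x₁,x₂) ∈ ℝ² of ( x₁² + x₁x₂² + λ₁(1 − x₁x₂²) + λ₂(1 − x₁) ) equals 2, which coincides with the primal optimal value of minimizing x₁² + x₁x₂² subject to x₁ ≥ 1 and x₁x₂² ≥ 1. -/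
/-- Strong duality for Example 2: the dual optimal value
`sup_{λ₁, λ₂ ≥ 0} inf_{(x₁, x₂)} (x₁² + x₁x₂² + λ₁(1 − x₁x₂²) + λ₂(1 − x₁))`
equals `2`, which coincides with the primal optimal value. -/
theorem example2_strong_duality :
    (⨆ lam : {l : ℝ × ℝ // 0 ≤ l.1 ∧ 0 ≤ l.2},
        ⨅ x : ℝ × ℝ,
          ((x.1 ^ 2 + x.1 * x.2 ^ 2 + lam.1.1 * (1 - x.1 * x.2 ^ 2)
              + lam.1.2 * (1 - x.1) : ℝ) : EReal)) = (2 : EReal) ∧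
    IsLeast {y : ℝ | ∃ x₁ x₂ : ℝ, 1 ≤ x₁ ∧ 1 ≤ x₁ * x₂ ^ 2 ∧ y = x₁ ^ 2 + x₁ * x₂ ^ 2} 2 := by
  refine ⟨le_antisymm (iSup_le fun lam => (iInf_le _ (1, 1)).trans ?_) ?_,
    ⟨1, 1, by norm_num, by norm_num, by norm_num⟩, ?_⟩
  · norm_num
    exact le_rfl
  · refine le_iSup_of_le ⟨(1, 2), by norm_num, by norm_num⟩ (le_iInf fun x => ?_)
    have h : (2 : ℝ) ≤ x.1 ^ 2 + x.1 * x.2 ^ 2 + 1 * (1 - x.1 * x.2 ^ 2) + 2 * (1 - x.1) := by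
      nlinarith [sq_nonneg (x.1 - 1)]
    exact EReal.coe_le_coe_iff.mpr h
  · rintro y ⟨x₁, x₂, h₁, h₂, rfl⟩
    nlinarith
end
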